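/- arXiv:2306.13736 — 2 statements merged into one kernel-verified Lean document; each statement's English description precedes it below -/
import Mathlib

section
/- Undecidability of satisfiability for a single binary relation: let L be the first-order language with exactly one binary relation symbol and no other non-logical symbols. The set of L-sentences that are satisfiable (have a model with nonempty domain) is not computable. -/
open FirstOrder FirstOrder.Language

/-- The first-order language with exactly one binary relation symbol and no other
non-logical symbols. -/
def binLang : Language :=
  ⟨fun _ => Empty, fun k =>
    match k with
    | 2 => Unit
    | _ => Empty⟩

instance (k : ℕ) : Encodable (binLang.Functions k) :=
  inferInstanceAs (Encodable Empty)

instance : ∀ k : ℕ, Encodable (binLang.Relations k)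
  | 0 => inferInstanceAs (Encodable Empty)
  | 1 => inferInstanceAs (Encodable Empty)
  | 2 => inferInstanceAs (Encodable Unit)
  | (_ + 3) => inferInstanceAs (Encodable Empty)

instance binGammaEncodable :
    Encodable (BoundedFormula.encoding (L := binLang) (α := Empty)).Γ :=
  inferInstanceAs
    (Encodable ((Σ k, binLang.Term (Empty ⊕ Fin k)) ⊕ ((Σ m, binLang.Relations m) ⊕ ℕ)))

/-- Sentences of the language are effectively encodable. -/
instance binSigmaEncodable : Encodable (Σ m, binLang.BoundedFormula Empty m) :=
  Encodable.ofLeftInjection BoundedFormula.encoding.encode BoundedFormula.encoding.decode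
    BoundedFormula.encoding.decode_encode

instance binSentenceEncodable : Encodable binLang.Sentence :=
  Encodable.ofLeftInjection
    (fun φ => (⟨0, φ⟩ : Σ m, binLang.BoundedFormula Empty m))
    (fun p =>
      match p with
      | ⟨0, φ⟩ => some φ
      | _ => none)
    (fun _ => rfl)

/-- A sentence is satisfiable iff it is true in some structure with nonempty domain. -/
def SatSentence (φ : binLang.Sentence) : Prop :=
  ∃ (M : Type) (S : binLang.Structure M), Nonempty M ∧
    @FirstOrder.Language.Sentence.Realize binLang M S φ

namespace BinSat

/-! ### Uniformly first-order definable predicates -/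

/-- The binary relation symbol of `binLang`. -/
abbrev relSym : binLang.Relations 2 := ()

/-- The interpretation of the relation symbol in a `binLang`-structure. -/
def rel (M : Type) [binLang.Structure M] (a b : M) : Prop :=
  Structure.RelMap relSym ![a, b]

/-- The `binLang`-structure given by a binary relation. -/
@[reducible] def structureOf {M : Type} (R : M → M → Prop) : binLang.Structure M where
  funMap f := f.elim
  RelMap {k} := match k with
    | 2 => fun _ xs => R (xs 0) (xs 1)
    | 0 => fun r _ => nomatch r
    | 1 => fun r _ => nomatch r
    | _ + 3 => fun r _ => nomatch r

/-- A family of predicates on valuations, one for each set with a binary relation, is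
*definable* if a single first-order formula expresses all of them. -/
def Definable {α : Type} (P : ∀ M : Type, (M → M → Prop) → (α → M) → Prop) : Prop :=
  ∃ φ : binLang.Formula α, ∀ (M : Type) [binLang.Structure M] (v : α → M),
    φ.Realize v ↔ P M (rel M) v

namespace Definable

variable {α β : Type} {P Q : ∀ M : Type, (M → M → Prop) → (α → M) → Prop}

theorem mem (a b : α) : Definable fun _ R (v : α → _) => R (v a) (v b) :=
  ⟨Relations.formula₂ relSym (.var a) (.var b), fun M _ v => by
    simp [Formula.realize_rel₂, rel]⟩

theorem eq (a b : α) : Definable fun _ _ (v : α → _) => v a = v b :=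
  ⟨Term.equal (.var a) (.var b), fun M _ v => by simp [Formula.realize_equal]⟩

theorem not (hP : Definable P) : Definable fun M R v => ¬ P M R v := by
  obtain ⟨φ, hφ⟩ := hP
  exact ⟨φ.not, fun M _ v => by simp [Formula.realize_not, hφ]⟩

theorem imp (hP : Definable P) (hQ : Definable Q) :
    Definable fun M R v => P M R v → Q M R v := by
  obtain ⟨φ, hφ⟩ := hP
  obtain ⟨ψ, hψ⟩ := hQ
  exact ⟨φ.imp ψ, fun M _ v => by simp [Formula.realize_imp, hφ, hψ]⟩

theorem and (hP : Definable P) (hQ : Definable Q) :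
    Definable fun M R v => P M R v ∧ Q M R v := by
  obtain ⟨φ, hφ⟩ := hP
  obtain ⟨ψ, hψ⟩ := hQ
  exact ⟨φ ⊓ ψ, fun M _ v => by simp [Formula.realize_inf, hφ, hψ]⟩

theorem or (hP : Definable P) (hQ : Definable Q) :
    Definable fun M R v => P M R v ∨ Q M R v := by
  obtain ⟨φ, hφ⟩ := hP
  obtain ⟨ψ, hψ⟩ := hQ
  exact ⟨φ ⊔ ψ, fun M _ v => by simp [Formula.realize_sup, hφ, hψ]⟩

theorem iff (hP : Definable P) (hQ : Definable Q) :
    Definable fun M R v => P M R v ↔ Q M R v := by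
  obtain ⟨φ, hφ⟩ := hP
  obtain ⟨ψ, hψ⟩ := hQ
  exact ⟨φ.iff ψ, fun M _ v => by simp [Formula.realize_iff, hφ, hψ]⟩

theorem forall_finite [Finite β] {P : β → ∀ M : Type, (M → M → Prop) → (α → M) → Prop}
    (hP : ∀ b, Definable (P b)) : Definable fun M R v => ∀ b, P b M R v := by
  choose φ hφ using hP
  exact ⟨Formula.iInf φ, fun M _ v => by simp [Formula.realize_iInf, hφ]⟩

theorem exists_tuple [Finite β] {P : ∀ M : Type, (M → M → Prop) → (α → M) → (β → M) → Prop}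
    (hP : Definable fun M R (v : α ⊕ β → M) =>
      P M R (fun a => v (.inl a)) (fun b => v (.inr b))) :
    Definable fun M R v => ∃ w, P M R v w := by
  obtain ⟨φ, hφ⟩ := hP
  exact ⟨φ.iExs β, fun M _ v => by simp [Formula.realize_iExs, hφ]⟩

theorem ex {P : ∀ M : Type, (M → M → Prop) → (α → M) → M → Prop}
    (hP : Definable fun M R (v : α ⊕ Unit → M) => P M R (fun a => v (.inl a)) (v (.inr ()))) :
    Definable fun M R v => ∃ x, P M R v x := by
  obtain ⟨φ, hφ⟩ := exists_tuple (P := fun M R v (w : Unit → M) => P M R v (w ())) hP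
  exact ⟨φ, fun M _ v => (hφ M v).trans
    ⟨fun ⟨w, hw⟩ => ⟨_, hw⟩, fun ⟨x, hx⟩ => ⟨fun _ => x, hx⟩⟩⟩

theorem all {P : ∀ M : Type, (M → M → Prop) → (α → M) → M → Prop}
    (hP : Definable fun M R (v : α ⊕ Unit → M) => P M R (fun a => v (.inl a)) (v (.inr ()))) :
    Definable fun M R v => ∀ x, P M R v x := by
  simpa using (ex (P := fun M R v x => ¬ P M R v x) hP.not).not

theorem relabel (hP : Definable P) (σ : α → β) :
    Definable fun M R v => P M R (fun a => v (σ a)) := by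
  obtain ⟨φ, hφ⟩ := hP
  exact ⟨φ.relabel σ, fun M _ v => by
    simp only [Formula.realize_relabel, hφ, Function.comp_def]⟩

end Definable

theorem map_vecCons {α β : Type} {n : ℕ} (g : α → β) (a : α) (x : Fin n → α) :
    g ∘ Matrix.vecCons a x = Matrix.vecCons (g a) (g ∘ x) :=
  Fin.comp_cons g a x

/-- A definable predicate of an `n`-tuple and one further element. -/
def DefinableGraph {n : ℕ} (P : ∀ M : Type, (M → M → Prop) → (Fin n → M) → M → Prop) : Prop :=
  Definable fun M R (v : Option (Fin n) → M) => P M R (fun i => v (some i)) (v none)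

theorem DefinableGraph.comp {n : ℕ} {α : Type}
    {P : ∀ M : Type, (M → M → Prop) → (Fin n → M) → M → Prop}
    (hP : DefinableGraph P) (a : Fin n → α) (b : α) :
    Definable fun M R (v : α → M) => P M R (fun i => v (a i)) (v b) :=
  hP.relabel fun o => o.elim b a

theorem DefinableGraph.comp_vecCons {n : ℕ} {α : Type}
    {P : ∀ M : Type, (M → M → Prop) → (Fin (n + 1) → M) → M → Prop}
    (hP : DefinableGraph P) (a : α) (b : Fin n → α) (c : α) :
    Definable fun M R (v : α → M) => P M R (Matrix.vecCons (v a) fun i => v (b i)) (v c) := by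
  simpa only [← Function.comp_def, map_vecCons] using
    hP.comp (Matrix.vecCons a b) c

theorem DefinableGraph.comp_vecCons_vecCons {n : ℕ} {α : Type}
    {P : ∀ M : Type, (M → M → Prop) → (Fin (n + 2) → M) → M → Prop}
    (hP : DefinableGraph P) (a b : α) (c : Fin n → α) (d : α) :
    Definable fun M R (v : α → M) =>
      P M R (Matrix.vecCons (v a) (Matrix.vecCons (v b) fun i => v (c i))) (v d) := by
  simpa only [← Function.comp_def, map_vecCons] using
    hP.comp (Matrix.vecCons a (Matrix.vecCons b c)) d

/-! ### Set-theoretic vocabulary -/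

section Vocabulary

variable {M : Type} (R : M → M → Prop)

/-- `y` has no elements. -/
def IsZero (y : M) : Prop := ∀ w, ¬ R w y

/-- `x` is the only element of `y`; on numerals, `y` is the successor of `x`. -/
def IsSingleton (y x : M) : Prop := R x y ∧ ∀ w, R w y → w = x

/-- The elements of `y` are exactly `a` and `b`. -/
def IsDoubleton (y a b : M) : Prop := R a y ∧ R b y ∧ ∀ w, R w y → w = a ∨ w = b

/-- `p` is a Kuratowski pair with components `a` and `b`. -/
def IsPair (p a b : M) : Prop :=
  ∃ s d, IsDoubleton R p s d ∧ IsSingleton R s a ∧ IsDoubleton R d a b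

/-- There is an empty set, and any element can be adjoined to any set. -/
def Adjunctive : Prop :=
  (∃ y, ∀ w, ¬ R w y) ∧ ∀ x y, ∃ z, ∀ w, R w z ↔ w = x ∨ R w y

variable {R}

theorem IsPair.unique {p a b a' b' : M} (h : IsPair R p a b) (h' : IsPair R p a' b') :
    a = a' ∧ b = b' := by
  obtain ⟨s, d, ⟨hs, hd, hp⟩, ⟨has, hs'⟩, had, hbd, hd'⟩ := h
  obtain ⟨t, e, ⟨ht, he, hq⟩, ⟨hat, ht'⟩, hae, hbe, he'⟩ := h'
  have haa : a = a' := by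
    rcases hp t ht with rfl | rfl
    · exact (hs' _ hat).symm
    · exact ht' _ had
  subst haa
  exact ⟨rfl, by grind⟩

end Vocabulary

theorem definable_isZero {α : Type} (y : α) : Definable fun _ R (v : α → _) => IsZero R (v y) :=
  .all (.not (.mem _ _))

theorem definable_isSingleton {α : Type} (y x : α) :
    Definable fun _ R (v : α → _) => IsSingleton R (v y) (v x) :=
  .and (.mem _ _) (.all (.imp (.mem _ _) (.eq _ _)))

theorem definable_isDoubleton {α : Type} (y a b : α) :
    Definable fun _ R (v : α → _) => IsDoubleton R (v y) (v a) (v b) :=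
  .and (.mem _ _) (.and (.mem _ _) (.all (.imp (.mem _ _) (.or (.eq _ _) (.eq _ _)))))

theorem definable_isPair {α : Type} (p a b : α) :
    Definable fun _ R (v : α → _) => IsPair R (v p) (v a) (v b) :=
  .ex (.ex (.and (definable_isDoubleton _ _ _)
    (.and (definable_isSingleton _ _) (definable_isDoubleton _ _ _))))

theorem definable_adjunctive {α : Type} :
    Definable fun M R (_ : α → M) => Adjunctive R :=
  .and (.ex (.all (.not (.mem _ _))))
    (.all (.all (.ex (.all (.iff (.mem _ _) (.or (.eq _ _) (.mem _ _)))))))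

/-! ### Hereditarily finite sets -/

/-- Hereditarily finite sets, presented as lists of hereditarily finite sets. -/
inductive HF : Type
  | nil : HF
  | cons : HF → HF → HF

namespace HF

/-- The membership relation on `HF`. -/
def Mem (x : HF) : HF → Prop
  | nil => False
  | cons a s => x = a ∨ Mem x s

/-- The rank of a hereditarily finite set. -/
def rank : HF → ℕ
  | nil => 0
  | cons a s => max (rank a + 1) (rank s)

theorem rank_le_iff {s : HF} {n : ℕ} : s.rank ≤ n ↔ ∀ x, Mem x s → x.rank < n := by
  induction s with
  | nil => simp [rank, Mem]
  | cons a s _ ih => simp [rank, Mem, ih]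

theorem rank_lt_of_mem {x s : HF} (h : Mem x s) : x.rank < s.rank :=
  rank_le_iff.1 le_rfl x h

theorem rank_eq_zero_of_isZero {s : HF} (h : IsZero Mem s) : s.rank = 0 :=
  Nat.le_zero.1 (rank_le_iff.2 fun x hx => (h x hx).elim)

theorem rank_eq_succ_of_isSingleton {s x : HF} (h : IsSingleton Mem s x) :
    s.rank = x.rank + 1 :=
  le_antisymm (rank_le_iff.2 fun y hy => by rw [h.2 y hy]; exact Nat.lt_succ_self _)
    (rank_lt_of_mem h.1)

theorem adjunctive_mem : Adjunctive Mem :=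
  ⟨⟨nil, fun _ h => h⟩, fun x y => ⟨cons x y, fun _ => Iff.rfl⟩⟩

/-- The Zermelo numerals. -/
def num : ℕ → HF
  | 0 => nil
  | n + 1 => cons (num n) nil

/-- The Kuratowski pair of two sets. -/
def pair (a b : HF) : HF := cons (cons a nil) (cons (cons a (cons b nil)) nil)

theorem exists_mem_iff (q : ℕ → HF) (n : ℕ) : ∃ s, ∀ w, Mem w s ↔ ∃ i ≤ n, w = q i := by
  induction n with
  | zero => exact ⟨cons (q 0) nil, fun w => by simp [Mem]⟩
  | succ n ih =>
    obtain ⟨s, hs⟩ := ih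
    exact ⟨cons (q (n + 1)) s, fun w => by simp [Mem, hs, Nat.le_succ_iff, or_and_right,
      exists_or, or_comm]⟩

/-- A map from `HF` that identifies the elements of `e s` with the elements of `s`. -/
def IsTransitiveMap {M : Type} (R : M → M → Prop) (e : HF → M) : Prop :=
  ∀ w s, R w (e s) ↔ ∃ x, Mem x s ∧ w = e x

theorem exists_isTransitiveMap {M : Type} {R : M → M → Prop} (h : Adjunctive R) :
    ∃ e, IsTransitiveMap R e := by
  obtain ⟨⟨z, hz⟩, hadj⟩ := h
  choose adj hadj using hadj
  refine ⟨fun s => s.rec z fun _ _ x y => adj x y, fun w s => ?_⟩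
  induction s with
  | nil => simp [hz, Mem]
  | cons a s _ ih => simp [hadj, ih, Mem, or_and_right, exists_or]

section TransitiveMap

variable {M : Type} {R : M → M → Prop} {e : HF → M}

theorem IsTransitiveMap.isZero (he : IsTransitiveMap R e) : IsZero R (e (num 0)) := fun w hw => by
  simp [he w, num, Mem] at hw

theorem IsTransitiveMap.isSingleton (he : IsTransitiveMap R e) (x : HF) :
    IsSingleton R (e (cons x nil)) (e x) := by
  simp [IsSingleton, he _ _, Mem]

theorem IsTransitiveMap.isDoubleton (he : IsTransitiveMap R e) (a b : HF) :
    IsDoubleton R (e (cons a (cons b nil))) (e a) (e b) := by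
  refine ⟨(he _ _).2 ⟨a, by simp [Mem]⟩, (he _ _).2 ⟨b, by simp [Mem]⟩, fun w hw => ?_⟩
  simpa [he w, Mem] using hw

theorem IsTransitiveMap.isPair (he : IsTransitiveMap R e) (a b : HF) :
    IsPair R (e (pair a b)) (e a) (e b) :=
  ⟨_, _, he.isDoubleton _ _, he.isSingleton _, he.isDoubleton _ _⟩

end TransitiveMap

end HF

/-! ### Representability of partial recursive functions -/

/-- A relation between tuples of numbers and numbers is *representable* if there is a definable
predicate which is sound for it in `HF`, numbers being read off as ranks, and which holds of its
instances in every structure that receives a transitive map from `HF`. -/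
def Representable {n : ℕ} (G : (Fin n → ℕ) → ℕ → Prop) : Prop :=
  ∃ P : ∀ M : Type, (M → M → Prop) → (Fin n → M) → M → Prop,
    DefinableGraph P ∧
    (∀ x y, P HF HF.Mem x y → G (fun i => (x i).rank) y.rank) ∧
    ∀ (M : Type) (R : M → M → Prop) (e : HF → M), HF.IsTransitiveMap R e →
      ∀ v k, G v k → P M R (fun i => e (HF.num (v i))) (e (HF.num k))

namespace Representable

open HF

variable {n : ℕ}

theorem congr {F G : (Fin n → ℕ) → ℕ → Prop} (hF : Representable F)
    (h : ∀ v k, F v k ↔ G v k) : Representable G := by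
  obtain rfl : F = G := funext fun v => funext fun k => propext (h v k)
  exact hF

theorem rank_vecCons {m : ℕ} (a : HF) (x : Fin m → HF) :
    (fun i => (Matrix.vecCons a x i).rank) = Matrix.vecCons a.rank fun i => (x i).rank :=
  map_vecCons rank a x

theorem num_vecCons {m : ℕ} {M : Type} (e : HF → M) (a : ℕ) (v : Fin m → ℕ) :
    (fun i => e (num (Matrix.vecCons a v i))) =
      Matrix.vecCons (e (num a)) fun i => e (num (v i)) :=
  map_vecCons (fun i => e (num i)) a v

theorem zero : Representable fun (_ : Fin n → ℕ) k => k = 0 := by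
  refine ⟨fun _ R _ y => IsZero R y, definable_isZero _, fun _ _ h => rank_eq_zero_of_isZero h, ?_⟩
  rintro M R e he v k rfl
  exact he.isZero

theorem succ (i : Fin n) : Representable fun v k => k = v i + 1 := by
  refine ⟨fun _ R x y => IsSingleton R y (x i), definable_isSingleton _ _,
    fun _ _ h => rank_eq_succ_of_isSingleton h, ?_⟩
  rintro M R e he v k rfl
  exact he.isSingleton _

theorem get (i : Fin n) : Representable fun v k => k = v i := by
  refine ⟨fun _ _ x y => y = x i, .eq _ _, fun _ _ h => congrArg rank h, ?_⟩
  rintro M R e he v k rfl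
  rfl

theorem comp {m : ℕ} {F : (Fin m → ℕ) → ℕ → Prop} {G : Fin m → (Fin n → ℕ) → ℕ → Prop}
    (hF : Representable F) (hG : ∀ i, Representable (G i)) :
    Representable fun v k => ∃ w, (∀ i, G i v (w i)) ∧ F w k := by
  obtain ⟨P, hP, hPs, hPc⟩ := hF
  choose Q hQ hQs hQc using hG
  refine ⟨fun M R x y => ∃ z, (∀ i, Q i M R x (z i)) ∧ P M R z y,
    .exists_tuple (.and (.forall_finite fun i => (hQ i).comp _ _) (hP.comp _ _)), ?_, ?_⟩
  · rintro x y ⟨z, hz, hy⟩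
    exact ⟨fun i => (z i).rank, fun i => hQs i _ _ (hz i), hPs _ _ hy⟩
  · rintro M R e he v k ⟨w, hw, hk⟩
    exact ⟨fun i => e (num (w i)), fun i => hQc i M R e he _ _ (hw i), hPc M R e he _ _ hk⟩

theorem prec {f : (Fin n → ℕ) → ℕ} {g : (Fin (n + 2) → ℕ) → ℕ}
    (hf : Representable fun v k => k = f v) (hg : Representable fun v k => k = g v) :
    Representable fun (v : Fin (n + 1) → ℕ) k =>
      k = (v 0).rec (f fun i => v i.succ)
        fun y r => g (Matrix.vecCons y (Matrix.vecCons r fun i => v i.succ)) := by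
  obtain ⟨P, hP, hPs, hPc⟩ := hf
  obtain ⟨Q, hQ, hQs, hQc⟩ := hg
  refine ⟨fun M R x y => ∃ s p, R p s ∧ IsPair R p (x 0) y ∧ ∀ p, R p s → ∃ a b, IsPair R p a b ∧
    ((IsZero R a ∧ P M R (fun i => x i.succ) b) ∨
      ∃ q, R q s ∧ ∃ a' b', IsPair R q a' b' ∧ IsSingleton R a a' ∧
        Q M R (Matrix.vecCons a' (Matrix.vecCons b' fun j => x j.succ)) b), ?_, ?_, ?_⟩
  · exact .ex (.ex (.and (.mem _ _) (.and (definable_isPair _ _ _) (.all (.imp (.mem _ _)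
      (.ex (.ex (.and (definable_isPair _ _ _) (.or (.and (definable_isZero _) (hP.comp _ _))
      (.ex (.and (.mem _ _) (.ex (.ex (.and (definable_isPair _ _ _)
      (.and (definable_isSingleton _ _) (hQ.comp_vecCons_vecCons _ _ _ _))))))))))))))))
  · rintro x y ⟨s, p, hps, hp, hs⟩
    have key : ∀ k p a b, Mem p s → IsPair Mem p a b → a.rank = k → b.rank =
        k.rec (f fun i => (x i.succ).rank)
          fun y r => g (Matrix.vecCons y (Matrix.vecCons r fun i => (x i.succ).rank)) := by
      intro k
      induction k with
      | zero =>
        intro p a b hps hp ha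
        obtain ⟨a₁, b₁, hp₁, ⟨-, h⟩ | ⟨q, -, a', b', -, hs', -⟩⟩ := hs p hps
        · obtain ⟨rfl, rfl⟩ := hp.unique hp₁
          exact hPs _ _ h
        · obtain ⟨rfl, rfl⟩ := hp.unique hp₁
          have := rank_eq_succ_of_isSingleton hs'
          omega
      | succ k ih =>
        intro p a b hps hp ha
        obtain ⟨a₁, b₁, hp₁, ⟨h, -⟩ | ⟨q, hqs, a', b', hq, hs', h⟩⟩ := hs p hps
        · obtain ⟨rfl, rfl⟩ := hp.unique hp₁
          have := rank_eq_zero_of_isZero h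
          omega
        · obtain ⟨rfl, rfl⟩ := hp.unique hp₁
          have hk : a'.rank = k := by
            have := rank_eq_succ_of_isSingleton hs'
            omega
          have := hQs _ _ h
          simp only [rank_vecCons] at this
          rw [this, ih q a' b' hqs hq hk, hk]
    exact key _ p _ _ hps hp rfl
  · rintro M R e he v k rfl
    set F : ℕ → ℕ := fun m => m.rec (f fun i => v i.succ)
      fun y r => g (Matrix.vecCons y (Matrix.vecCons r fun i => v i.succ)) with hF
    obtain ⟨s, hs⟩ := exists_mem_iff (fun i => pair (num i) (num (F i))) (v 0)
    have hmem : ∀ i ≤ v 0, R (e (pair (num i) (num (F i)))) (e s) :=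
      fun i hi => (he _ _).2 ⟨_, (hs _).2 ⟨i, hi, rfl⟩, rfl⟩
    refine ⟨e s, _, hmem _ le_rfl, he.isPair _ _, fun p hp => ?_⟩
    obtain ⟨_, hw, rfl⟩ := (he _ _).1 hp
    obtain ⟨i, hi, rfl⟩ := (hs _).1 hw
    refine ⟨_, _, he.isPair _ _, ?_⟩
    cases i with
    | zero => exact .inl ⟨he.isZero, hPc M R e he _ _ rfl⟩
    | succ i =>
      refine .inr ⟨_, hmem i (by omega), _, _, he.isPair _ _, he.isSingleton _, ?_⟩
      have := hQc M R e he (Matrix.vecCons i (Matrix.vecCons (F i) fun j => v j.succ)) _ rfl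
      rwa [num_vecCons, num_vecCons] at this

theorem rfind {f : (Fin (n + 1) → ℕ) → ℕ} (hf : Representable fun v k => k = f v) :
    Representable fun v k =>
      f (Matrix.vecCons k v) = 0 ∧ ∀ m < k, f (Matrix.vecCons m v) ≠ 0 := by
  obtain ⟨P, hP, hPs, hPc⟩ := hf
  refine ⟨fun M R x y => (∃ z, IsZero R z ∧ P M R (Matrix.vecCons y fun i => x i) z) ∧
    ∃ s, R y s ∧ ∀ a, R a s → IsZero R a ∨ ∃ a', R a' s ∧ IsSingleton R a a' ∧
      ∃ z, (∃ w, R w z) ∧ P M R (Matrix.vecCons a' fun i => x i) z, ?_, ?_, ?_⟩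
  · exact .and (.ex (.and (definable_isZero _) (hP.comp_vecCons _ _ _)))
      (.ex (.and (.mem _ _) (.all (.imp (.mem _ _) (.or (definable_isZero _) (.ex (.and (.mem _ _)
      (.and (definable_isSingleton _ _)
      (.ex (.and (.ex (.mem _ _)) (hP.comp_vecCons _ _ _)))))))))))
  · rintro x y ⟨⟨z, hz, hPz⟩, s, hys, hs⟩
    have hz0 := hPs _ _ hPz
    rw [rank_vecCons, rank_eq_zero_of_isZero hz] at hz0
    refine ⟨hz0.symm, ?_⟩
    have key : ∀ k a, Mem a s → a.rank = k →
        ∀ m < k, f (Matrix.vecCons m fun i => (x i).rank) ≠ 0 := by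
      intro k
      induction k with
      | zero => simp
      | succ k ih =>
        intro a has ha m hm
        obtain h | ⟨a', has', hs', z, ⟨w, hw⟩, hPz⟩ := hs a has
        · have := rank_eq_zero_of_isZero h
          omega
        · have hk : a'.rank = k := by
            have := rank_eq_succ_of_isSingleton hs'
            omega
          rcases Nat.lt_succ_iff_lt_or_eq.1 hm with hm | rfl
          · exact ih a' has' hk m hm
          · have := hPs _ _ hPz
            rw [rank_vecCons, hk] at this
            have := rank_lt_of_mem hw
            omega
    exact key _ y hys rfl
  · rintro M R e he v k ⟨hk, hlt⟩
    obtain ⟨s, hs⟩ := exists_mem_iff num k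
    have hmem : ∀ i ≤ k, R (e (num i)) (e s) :=
      fun i hi => (he _ _).2 ⟨_, (hs _).2 ⟨i, hi, rfl⟩, rfl⟩
    have hP' (m : ℕ) : P M R (Matrix.vecCons (e (num m)) fun i => e (num (v i)))
        (e (num (f (Matrix.vecCons m v)))) := by
      have := hPc M R e he (Matrix.vecCons m v) _ rfl
      rwa [num_vecCons] at this
    refine ⟨⟨_, he.isZero, hk ▸ hP' k⟩, e s, hmem k le_rfl, fun a ha => ?_⟩
    obtain ⟨_, hw, rfl⟩ := (he _ _).1 ha
    obtain ⟨i, hi, rfl⟩ := (hs _).1 hw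
    cases i with
    | zero => exact .inl he.isZero
    | succ i =>
      refine .inr ⟨_, hmem i (by omega), he.isSingleton _, _, ?_, hP' i⟩
      obtain ⟨j, hj⟩ := Nat.exists_eq_succ_of_ne_zero (hlt i (by omega))
      rw [hj]
      exact ⟨_, (he.isSingleton _).1⟩

theorem of_primrec' {f : List.Vector ℕ n → ℕ} (hf : Nat.Primrec' f) :
    Representable fun v k => k = f (.ofFn v) := by
  induction hf with
  | zero => exact zero
  | succ => simpa [List.Vector.ofFn] using succ (n := 1) 0
  | get i => simpa using get i
  | comp g _ _ ihf ihg =>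
    refine (comp ihf ihg).congr fun v k => ⟨?_, fun h => ⟨_, fun _ => rfl, h⟩⟩
    rintro ⟨w, hw, rfl⟩
    rw [funext hw]
  | prec _ _ ihf ihg =>
    refine (prec ihf ihg).congr fun v k => ?_
    simp [List.Vector.ofFn]

theorem mem_mOfFn {m : ℕ} (p : Fin m → Part ℕ) (w : List.Vector ℕ m) :
    w ∈ List.Vector.mOfFn p ↔ ∀ i, w.get i ∈ p i := by
  induction m with
  | zero => simp [List.Vector.mOfFn, eq_iff_true_of_subsingleton]
  | succ m ih =>
    cases w using List.Vector.casesOn with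
    | cons a w =>
      simp only [List.Vector.mOfFn, Part.bind_eq_bind, Part.pure_eq_some, Part.mem_bind_iff,
        Part.mem_some_iff, ih, Fin.forall_fin_succ, List.Vector.get_zero, List.Vector.head_cons,
        List.Vector.get_cons_succ]
      constructor
      · rintro ⟨b, hb, u, hu, h⟩
        obtain ⟨rfl, rfl⟩ : a = b ∧ w = u :=
          ⟨congrArg List.Vector.head h, congrArg List.Vector.tail h⟩
        exact ⟨hb, hu⟩
      · rintro ⟨ha, hw⟩
        exact ⟨a, ha, w, hw, rfl⟩

theorem of_partrec' {f : List.Vector ℕ n →. ℕ} (hf : Nat.Partrec' f) :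
    Representable fun v k => k ∈ f (.ofFn v) := by
  induction hf with
  | prim hf => simpa using of_primrec' hf
  | comp g _ _ ihf ihg =>
    refine (comp ihf ihg).congr fun v k => ?_
    refine Iff.trans ?_ Part.mem_bind_iff.symm
    simp only [mem_mOfFn]
    exact ⟨fun ⟨w, hw, h⟩ => ⟨.ofFn w, by simpa using hw, h⟩,
      fun ⟨w, hw, h⟩ => ⟨w.get, hw, by simpa using h⟩⟩
  | rfind _ ih =>
    simp only [PFun.coe_val, Part.mem_some_iff] at ih
    refine (rfind ih).congr fun v k => Iff.trans ?_ Nat.mem_rfind.symm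
    simp [List.Vector.ofFn, eq_comm]

end Representable

/-! ### The reduction -/

/-- The term naming the bound variable `i` at level `k`. -/
abbrev bdVar {k : ℕ} (i : Fin k) : binLang.Term (Empty ⊕ Fin k) := .var (.inr i)

/-- The atomic formula relating the bound variables `i` and `j`. -/
abbrev memFormula {k : ℕ} (i j : Fin k) : binLang.BoundedFormula Empty k :=
  .rel relSym ![bdVar i, bdVar j]

/-- `x` is a Zermelo numeral with value `m`. -/
def HasValue {M : Type} (R : M → M → Prop) : ℕ → M → Prop
  | 0, x => IsZero R x
  | m + 1, x => ∃ y, IsSingleton R x y ∧ HasValue R m y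

theorem HF.rank_eq_of_hasValue {m : ℕ} {x : HF} (h : HasValue Mem m x) : x.rank = m := by
  induction m generalizing x with
  | zero => exact rank_eq_zero_of_isZero h
  | succ m ih =>
    obtain ⟨y, hy, h⟩ := h
    rw [rank_eq_succ_of_isSingleton hy, ih h]

theorem HF.IsTransitiveMap.hasValue {M : Type} {R : M → M → Prop} {e : HF → M}
    (he : IsTransitiveMap R e) (m : ℕ) : HasValue R m (e (num m)) := by
  induction m with
  | zero => exact he.isZero
  | succ m ih => exact ⟨_, he.isSingleton _, ih⟩

/-- The formula stating that the last of `k + 1` bound variables does not have value `m`. -/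
def notValue : (m k : ℕ) → binLang.BoundedFormula Empty (k + 1)
  | 0, k => .imp (.all (.imp
      (memFormula (k := k + 2) ⟨k + 1, by omega⟩ ⟨k, by omega⟩) .falsum)) .falsum
  | m + 1, k => .all (.imp (memFormula (k := k + 2) ⟨k + 1, by omega⟩ ⟨k, by omega⟩) (.imp
      (.all (.imp (memFormula (k := k + 3) ⟨k + 2, by omega⟩ ⟨k, by omega⟩)
        (.equal (bdVar ⟨k + 2, by omega⟩) (bdVar ⟨k + 1, by omega⟩))))
      (notValue m (k + 1))))

theorem realize_memFormula {M : Type} [binLang.Structure M] {k : ℕ} (i j : Fin k)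
    (v : Empty → M) (xs : Fin k → M) :
    (memFormula i j).Realize v xs ↔ rel M (xs i) (xs j) := by
  rw [rel, memFormula, BoundedFormula.Realize]
  apply iff_of_eq
  congr 1
  funext l
  fin_cases l <;> rfl

theorem snoc_mk {M : Type} {k i : ℕ} (xs : Fin k → M) (x : M) (h : i < k + 1) :
    (Fin.snoc xs x : Fin (k + 1) → M) ⟨i, h⟩ = if h' : i < k then xs ⟨i, h'⟩ else x := by
  simp [Fin.snoc]

theorem realize_notValue {M : Type} [binLang.Structure M] (m k : ℕ) (v : Empty → M)
    (xs : Fin (k + 1) → M) :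
    (notValue m k).Realize v xs ↔ ¬ HasValue (rel M) m (xs (Fin.last k)) := by
  induction m generalizing k with
  | zero =>
    simp only [notValue, BoundedFormula.realize_imp, BoundedFormula.realize_all,
      realize_memFormula, snoc_mk]
    simp [BoundedFormula.Realize, HasValue, IsZero, Fin.last]
  | succ m ih =>
    simp only [notValue, BoundedFormula.realize_imp, BoundedFormula.realize_all,
      realize_memFormula, ih, snoc_mk, Fin.snoc_last]
    simp [BoundedFormula.Realize, HasValue, IsSingleton, Fin.last, snoc_mk]

/-- The list of codes of the symbols of a formula. -/
def code {n : ℕ} (φ : binLang.BoundedFormula Empty n) : List ℕ :=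
  φ.listEncode.map fun a => Encodable.encode a

theorem encode_eq_encode_code (φ : binLang.Sentence) :
    Encodable.encode φ = Encodable.encode (code φ) := by
  have h (l : List ((Σ k, binLang.Term (Empty ⊕ Fin k)) ⊕ ((Σ m, binLang.Relations m) ⊕ ℕ))) :
      Encodable.encode l = Encodable.encode (l.map fun a => Encodable.encode a) := by
    induction l with
    | nil => rfl
    | cons a l ih => simp [Encodable.encode_list_cons, ih]
  exact h _

/-- The code of the logical symbol number `j`. -/
def symbolCode (j : ℕ) : ℕ := 2 * (2 * j + 1) + 1

/-- The code of the relation symbol. -/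
def relCode : ℕ := 2 * (2 * Nat.pair 2 0) + 1

/-- The code of the variable `i` at level `k`. -/
def varCode (k i : ℕ) : ℕ := 2 * Nat.pair k (Nat.pair (2 * (2 * i + 1)) 0 + 1)

theorem code_falsum (n : ℕ) :
    code (.falsum : binLang.BoundedFormula Empty n) = [symbolCode (n + 2)] := rfl

theorem code_imp {n : ℕ} (φ ψ : binLang.BoundedFormula Empty n) :
    code (φ.imp ψ) = symbolCode 0 :: (code φ ++ code ψ) := by
  simp [code, BoundedFormula.listEncode, symbolCode]

theorem code_all {n : ℕ} (φ : binLang.BoundedFormula Empty (n + 1)) :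
    code φ.all = symbolCode 1 :: code φ := rfl

theorem code_equal {n : ℕ} (i j : Fin n) :
    code (.equal (bdVar i) (bdVar j)) = [varCode n i, varCode n j] := rfl

theorem code_memFormula {n : ℕ} (i j : Fin n) :
    code (memFormula i j) = [relCode, symbolCode n, varCode n i, varCode n j] := rfl

/-- The part of the code of `notValue (m + 1) k` that precedes the code of
`notValue m (k + 1)`. -/
def stepCode (k : ℕ) : List ℕ :=
  [symbolCode 1, symbolCode 0, relCode, symbolCode (k + 2), varCode (k + 2) (k + 1),
    varCode (k + 2) k, symbolCode 0, symbolCode 1, symbolCode 0, relCode, symbolCode (k + 3),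
    varCode (k + 3) (k + 2), varCode (k + 3) k, varCode (k + 3) (k + 2), varCode (k + 3) (k + 1)]

theorem code_notValue_succ (m k : ℕ) :
    code (notValue (m + 1) k) = stepCode k ++ code (notValue m (k + 1)) := by
  rw [notValue]
  simp only [code_all, code_imp, code_memFormula, code_equal]
  rfl

theorem code_notValue (m k : ℕ) :
    code (notValue m k) =
      (List.range m).flatMap (fun i => stepCode (k + i)) ++ code (notValue 0 (k + m)) := by
  induction m generalizing k with
  | zero => simp
  | succ m ih =>
    have h (i : ℕ) : k + 1 + i = k + (i + 1) := by omega
    rw [code_notValue_succ, ih, List.range_succ_eq_map, List.flatMap_cons, List.flatMap_map,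
      List.append_assoc, h m]
    simp only [h, Nat.add_zero, Nat.succ_eq_add_one]

section Primrec

open Primrec

theorem primrec_symbolCode : Primrec symbolCode :=
  succ.comp (nat_mul.comp (const 2) (succ.comp (nat_mul.comp (const 2) .id)))

theorem primrec_varCode : Primrec₂ varCode :=
  nat_mul.comp (const 2) (Primrec₂.natPair.comp fst (succ.comp (Primrec₂.natPair.comp
    (nat_mul.comp (const 2) (succ.comp (nat_mul.comp (const 2) snd))) (const 0))))

theorem primrec_add_const (a : ℕ) : Primrec fun k => k + a := nat_add.comp .id (const a)

theorem primrec_cons {f : ℕ → ℕ} {l : ℕ → List ℕ} (hf : Primrec f) (hl : Primrec l) :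
    Primrec fun k => f k :: l k :=
  list_cons.comp hf hl

theorem primrec_symbolCode_add (a : ℕ) : Primrec fun k => symbolCode (k + a) :=
  primrec_symbolCode.comp (primrec_add_const a)

theorem primrec_varCode_add (a b : ℕ) : Primrec fun k => varCode (k + a) (k + b) :=
  primrec_varCode.comp (primrec_add_const a) (primrec_add_const b)

theorem primrec_stepCode : Primrec stepCode :=
  primrec_cons (const _) <| primrec_cons (const _) <| primrec_cons (const _) <|
  primrec_cons (primrec_symbolCode_add 2) <| primrec_cons (primrec_varCode_add 2 1) <|
  primrec_cons (primrec_varCode_add 2 0) <| primrec_cons (const _) <| primrec_cons (const _) <|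
  primrec_cons (const _) <| primrec_cons (const _) <| primrec_cons (primrec_symbolCode_add 3) <|
  primrec_cons (primrec_varCode_add 3 2) <| primrec_cons (primrec_varCode_add 3 0) <|
  primrec_cons (primrec_varCode_add 3 2) <| primrec_cons (primrec_varCode_add 3 1) (const _)

theorem primrec_code_notValue_zero : Primrec fun k => code (notValue 0 k) := by
  simp only [notValue, code_all, code_imp, code_memFormula, code_falsum, List.cons_append,
    List.nil_append]
  exact primrec_cons (const _) <| primrec_cons (const _) <| primrec_cons (const _) <|
    primrec_cons (const _) <| primrec_cons (primrec_symbolCode_add 2) <|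
    primrec_cons (primrec_varCode_add 2 1) <| primrec_cons (primrec_varCode_add 2 0) <|
    primrec_cons (primrec_symbolCode_add 4) <| primrec_cons (primrec_symbolCode_add 3) (const _)

theorem primrec_code_notValue : Primrec fun m => code (notValue m 0) := by
  refine (list_append.comp (list_flatMap list_range (primrec_stepCode.comp snd).to₂)
    primrec_code_notValue_zero).of_eq fun m => ?_
  rw [code_notValue m 0, Nat.zero_add]
  simp only [Nat.zero_add]

end Primrec

/-- The sentence stating `τ`, and that no element satisfying `ψ` has value `m`. -/
def reductionSentence (τ : binLang.Sentence) (ψ : binLang.BoundedFormula Empty 1) (m : ℕ) :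
    binLang.Sentence :=
  .imp (.imp τ (.imp (.all (.imp ψ (notValue m 0))) .falsum)) .falsum

theorem primrec_encode_reductionSentence (τ : binLang.Sentence)
    (ψ : binLang.BoundedFormula Empty 1) :
    Primrec fun m => Encodable.encode (reductionSentence τ ψ m) := by
  simp only [encode_eq_encode_code, reductionSentence, code_imp, code_all, code_falsum]
  have happ (l : List ℕ) {f : ℕ → List ℕ} (hf : Primrec f) : Primrec fun m => l ++ f m :=
    Primrec.list_append.comp (.const l) hf
  have happ' (l : List ℕ) {f : ℕ → List ℕ} (hf : Primrec f) : Primrec fun m => f m ++ l :=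
    Primrec.list_append.comp hf (.const l)
  exact Primrec.encode.comp <| primrec_cons (.const _) <| happ' _ <| primrec_cons (.const _) <|
    happ _ <| primrec_cons (.const _) <| happ' _ <| primrec_cons (.const _) <|
    primrec_cons (.const _) <| happ _ primrec_code_notValue

theorem realize_reductionSentence {M : Type} [binLang.Structure M] {τ : binLang.Sentence}
    {ψ : binLang.BoundedFormula Empty 1} {m : ℕ} :
    (reductionSentence τ ψ m).Realize M ↔
      τ.Realize M ∧ ∀ x : M, ψ.Realize default ![x] → ¬ HasValue (rel M) m x := by
  have h (x : M) : (Fin.snoc default x : Fin 1 → M) = ![x] := by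
    funext i
    fin_cases i
    rfl
  simp only [reductionSentence, Sentence.Realize, Formula.Realize, BoundedFormula.realize_imp,
    BoundedFormula.realize_all, realize_notValue, h]
  simp [BoundedFormula.Realize]

/-- Domains of partial recursive functions reduce to unsatisfiability. -/
theorem exists_satSentence_iff_not_dom {f : ℕ →. ℕ} (hf : Nat.Partrec f) :
    ∃ φ : ℕ → binLang.Sentence, (Primrec fun m => Encodable.encode (φ m)) ∧
      ∀ m, SatSentence (φ m) ↔ ¬ (f m).Dom := by
  obtain ⟨P, hP, hPs, hPc⟩ :=
    Representable.of_partrec' (Nat.Partrec'.part_iff₁.2 (Partrec.nat_iff.2 hf))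
  obtain ⟨τ, hτ⟩ := definable_adjunctive (α := Empty)
  obtain ⟨χ, hχ⟩ : Definable fun M R (v : Fin 1 → M) => ∃ y, P M R v y :=
    .ex (hP.comp Sum.inl (Sum.inr ()))
  have hψ (M : Type) [binLang.Structure M] (x : M) :
      (BoundedFormula.relabel (n := 1) (fun i : Fin 1 => (.inr i : Empty ⊕ Fin 1))
        χ).Realize default ![x] ↔ ∃ y, P M (rel M) ![x] y := by
    refine Iff.trans ?_ (hχ M ![x])
    exact Formula.realize_relabel_sumInr χ
  refine ⟨reductionSentence τ (BoundedFormula.relabel (n := 1) (fun i => .inr i) χ),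
    primrec_encode_reductionSentence _ _, fun m => ⟨?_, fun hm => ?_⟩⟩
  · rintro ⟨M, S, -, h⟩ hm
    rw [realize_reductionSentence] at h
    obtain ⟨e, he⟩ := HF.exists_isTransitiveMap ((hτ M _).1 h.1)
    obtain ⟨k, hk⟩ := Part.dom_iff_mem.1 hm
    have := hPc M (rel M) e he (fun _ => m) k hk
    refine h.2 _ ((hψ M _).2 ⟨e (HF.num k), ?_⟩) (he.hasValue m)
    convert this using 1
    funext i
    fin_cases i
    rfl
  · let _ := structureOf HF.Mem
    refine ⟨HF, structureOf HF.Mem, ⟨.nil⟩, realize_reductionSentence.2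
      ⟨(hτ HF _).2 HF.adjunctive_mem, fun x hx hv => hm ?_⟩⟩
    obtain ⟨y, hy⟩ := (hψ HF x).1 hx
    have := hPs _ _ hy
    have hx := HF.rank_eq_of_hasValue hv
    refine Part.dom_iff_mem.2 ⟨y.rank, ?_⟩
    rw [← hx]
    exact this

end BinSat

/-- Undecidability of satisfiability for a single binary relation: no algorithm decides,
given a sentence whose only non-logical symbol is one binary predicate letter, whether it
has a model with nonempty domain. -/
theorem binary_relation_satisfiability_undecidable :
    ¬ ∃ f : ℕ → Bool, Computable f ∧
      ∀ φ : binLang.Sentence, (f (Encodable.encode φ) = true ↔ SatSentence φ) := by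
  rintro ⟨f, hf, h⟩
  obtain ⟨φ, hφ, hsat⟩ := BinSat.exists_satSentence_iff_not_dom
    (f := fun n => Nat.Partrec.Code.eval (Denumerable.ofNat Nat.Partrec.Code n) 0)
    (Partrec.nat_iff.1 (Nat.Partrec.Code.eval_part.comp (Computable.ofNat _)
      (Computable.const 0)))
  refine ComputablePred.halting_problem 0 (ComputablePred.computable_iff.2
    ⟨fun c => !f (Encodable.encode (φ (Encodable.encode c))),
      Primrec.not.to_comp.comp (hf.comp (hφ.to_comp.comp Computable.encode)), ?_⟩)
  funext c
  have hc := (h _).trans (hsat (Encodable.encode c))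
  rw [Denumerable.ofNat_encode] at hc
  simp only [Bool.not_eq_true', ← Bool.not_eq_true, hc, not_not]
end

section
/- Undecidability of finite satisfiability for a single binary relation: let L be the first-order language with exactly one binary relation symbol and no other non-logical symbols. The set of L-sentences that are satisfiable in some finite structure (i.e., have a model whose domain is a nonempty finite set) is not computable. -/
open FirstOrder FirstOrder.Language

/-- A sentence is finitely satisfiable iff it is true in some structure whose domain is a
nonempty finite set. -/
def FinSatSentence (φ : binLang.Sentence) : Prop :=
  ∃ (M : Type) (S : binLang.Structure M), Nonempty M ∧ Finite M ∧
    @FirstOrder.Language.Sentence.Realize binLang M S φ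

namespace BinaryTrakhtenbrot

/-! ### Definability over a single binary relation -/

/-- The symbol of the binary relation. -/
def memSymb : binLang.Relations 2 := ()

/-- The binary relation of a structure. -/
def memRel {M : Type} (S : binLang.Structure M) (a b : M) : Prop := S.RelMap memSymb ![a, b]

/-- The structure with a given binary relation. -/
abbrev structureOf {M : Type} (E : M → M → Prop) : binLang.Structure M where
  funMap f := f.elim
  RelMap {n} _ xs := ∃ h : n = 2, E (xs (Fin.cast h.symm 0)) (xs (Fin.cast h.symm 1))

theorem memRel_structureOf {M : Type} (E : M → M → Prop) : memRel (structureOf E) = E := by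
  funext a b
  exact propext ⟨fun ⟨_, h⟩ => h, fun h => ⟨rfl, h⟩⟩

/-- A property of assignments of the variables `α`, given uniformly for all binary relations. -/
abbrev Property (α : Type) := ∀ M : Type, (M → M → Prop) → (α → M) → Prop

/-- A property is definable if some first-order formula expresses it in every structure. -/
def Definable {α : Type} (R : Property α) : Prop :=
  ∃ φ : binLang.Formula α, ∀ (M : Type) (S : binLang.Structure M) (v : α → M),
    φ.Realize v ↔ R M (memRel S) v

namespace Definable

variable {α β : Type} {R R' : Property α}

theorem mem (a b : α) : Definable fun _ E v => E (v a) (v b) :=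
  ⟨memSymb.formula₂ (Term.var a) (Term.var b), fun _ _ _ => by
    simp [Formula.realize_rel₂, memRel]⟩

theorem eq (a b : α) : Definable fun _ _ v => v a = v b :=
  ⟨(Term.var a).equal (Term.var b), fun _ _ _ => by simp⟩

theorem not (h : Definable R) : Definable fun M E v => ¬ R M E v := by
  obtain ⟨φ, hφ⟩ := h
  exact ⟨φ.not, fun M S v => by rw [Formula.realize_not, hφ]⟩

theorem and (h : Definable R) (h' : Definable R') :
    Definable fun M E v => R M E v ∧ R' M E v := by
  obtain ⟨φ, hφ⟩ := h
  obtain ⟨ψ, hψ⟩ := h'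
  exact ⟨φ ⊓ ψ, fun M S v => by rw [Formula.realize_inf, hφ, hψ]⟩

theorem or (h : Definable R) (h' : Definable R') :
    Definable fun M E v => R M E v ∨ R' M E v := by
  obtain ⟨φ, hφ⟩ := h
  obtain ⟨ψ, hψ⟩ := h'
  exact ⟨φ ⊔ ψ, fun M S v => by rw [Formula.realize_sup, hφ, hψ]⟩

theorem imp (h : Definable R) (h' : Definable R') :
    Definable fun M E v => R M E v → R' M E v := by
  obtain ⟨φ, hφ⟩ := h
  obtain ⟨ψ, hψ⟩ := h'
  exact ⟨φ.imp ψ, fun M S v => by rw [Formula.realize_imp, hφ, hψ]⟩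

theorem iff (h : Definable R) (h' : Definable R') :
    Definable fun M E v => (R M E v ↔ R' M E v) := by
  obtain ⟨φ, hφ⟩ := h
  obtain ⟨ψ, hψ⟩ := h'
  exact ⟨φ.iff ψ, fun M S v => by rw [Formula.realize_iff, hφ, hψ]⟩

theorem forall_finite {ι : Type} [Finite ι] {R : ι → Property α} (h : ∀ i, Definable (R i)) :
    Definable fun M E v => ∀ i, R i M E v := by
  choose φ hφ using h
  exact ⟨Formula.iInf φ, fun M S v => by simp only [Formula.realize_iInf, hφ]⟩

theorem comap (h : Definable R) (g : α → β) : Definable fun M E v => R M E (fun a => v (g a)) := by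
  obtain ⟨φ, hφ⟩ := h
  exact ⟨φ.relabel g, fun M S v => by rw [Formula.realize_relabel, hφ]; rfl⟩

theorem exists_tuple [Finite β] {P : ∀ M : Type, (M → M → Prop) → (β → M) → (α → M) → Prop}
    (h : Definable fun M E (v : α ⊕ β → M) =>
      P M E (fun b => v (Sum.inr b)) (fun a => v (Sum.inl a))) :
    Definable fun M E v => ∃ w, P M E w v := by
  obtain ⟨φ, hφ⟩ := h
  exact ⟨φ.iExs β, fun M S v => by simp only [Formula.realize_iExs, hφ]; rfl⟩

theorem ex {P : ∀ M : Type, (M → M → Prop) → M → (α → M) → Prop}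
    (h : Definable fun M E (v : Option α → M) => P M E (v none) (fun a => v (some a))) :
    Definable fun M E v => ∃ x, P M E x v := by
  have h₁ : Definable fun M E (v : α ⊕ Unit → M) =>
      P M E (v (Sum.inr ())) (fun a => v (Sum.inl a)) :=
    h.comap fun o : Option α => o.elim (Sum.inr ()) Sum.inl
  obtain ⟨φ, hφ⟩ := exists_tuple (P := fun M E w v => P M E (w ()) v) h₁
  exact ⟨φ, fun M S v => (hφ M S v).trans
    ⟨fun ⟨w, hw⟩ => ⟨w (), hw⟩, fun ⟨x, hx⟩ => ⟨fun _ => x, hx⟩⟩⟩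

theorem all {P : ∀ M : Type, (M → M → Prop) → M → (α → M) → Prop}
    (h : Definable fun M E (v : Option α → M) => P M E (v none) (fun a => v (some a))) :
    Definable fun M E v => ∀ x, P M E x v := by
  obtain ⟨φ, hφ⟩ := (ex (P := fun M E x v => ¬ P M E x v) h.not).not
  exact ⟨φ, fun M S v => (hφ M S v).trans (by push Not; rfl)⟩

end Definable

/-! ### Numerals and pairs -/

section Sets

variable {M : Type} (E : M → M → Prop)

/-- `x` has no elements. -/
def IsZero (x : M) : Prop := ∀ t, ¬ E t x

/-- `b` is a singleton of `a`, the successor of `a` among Zermelo numerals. -/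
def IsSucc (a b : M) : Prop := ∀ t, E t b ↔ t = a

/-- `p` is a Kuratowski pair of `a` and `b`. -/
def IsPair (p a b : M) : Prop :=
  ∃ u w, (∀ t, E t p ↔ t = u ∨ t = w) ∧ (∀ t, E t u ↔ t = a) ∧ ∀ t, E t w ↔ t = a ∨ t = b

/-- `x` is a Zermelo numeral for the natural number. -/
def IsNumeral : ℕ → M → Prop
  | 0, x => IsZero E x
  | n + 1, x => ∃ y, IsSucc E y x ∧ IsNumeral n y

variable {E}

theorem IsPair.injective {p a b a' b' : M} (h : IsPair E p a b) (h' : IsPair E p a' b') :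
    a = a' ∧ b = b' := by
  obtain ⟨u, w, hp, hu, hw⟩ := h
  obtain ⟨u', w', hp', hu', hw'⟩ := h'
  have := hp' u
  have := hp' w
  have := hp u'
  have := hp w'
  have := hu a
  have := hu' a'
  have := hw a
  have := hw' a'
  have := hw b
  have := hw' b'
  grind

theorem IsSucc.injective {a a' b : M} (h : IsSucc E a b) (h' : IsSucc E a' b) : a = a' :=
  (h' a).1 ((h a).2 rfl)

theorem IsSucc.not_isZero {a b : M} (h : IsSucc E a b) : ¬ IsZero E b :=
  fun h' => h' a ((h a).2 rfl)

theorem IsNumeral.unique : ∀ {m n : ℕ} {x : M}, IsNumeral E m x → IsNumeral E n x → m = n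
  | 0, 0, _, _, _ => rfl
  | 0, _ + 1, _, h, ⟨_, h', _⟩ => absurd h h'.not_isZero
  | _ + 1, 0, _, ⟨_, h, _⟩, h' => absurd h' h.not_isZero
  | _ + 1, _ + 1, _, ⟨_, h, hm⟩, ⟨_, h', hn⟩ => by
    cases h.injective h'
    rw [hm.unique hn]

theorem IsNumeral.eq_zero {n : ℕ} {x : M} (h : IsNumeral E n x) (h' : IsZero E x) : n = 0 :=
  h.unique (n := 0) h'

theorem IsNumeral.pred {n : ℕ} {x y : M} (h : IsNumeral E (n + 1) x) (h' : IsSucc E y x) :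
    IsNumeral E n y := by
  obtain ⟨z, hz, hn⟩ := h
  exact hz.injective h' ▸ hn

end Sets

namespace Definable

variable {α : Type}

theorem isZero (a : α) : Definable fun _ E v => IsZero E (v a) :=
  all (P := fun _ E t v => ¬ E t (v a)) (mem none (some a)).not

theorem isSucc (a b : α) : Definable fun _ E v => IsSucc E (v a) (v b) :=
  all (P := fun _ E t v => E t (v b) ↔ t = v a) ((mem none (some b)).iff (eq none (some a)))

theorem isPair (p a b : α) : Definable fun _ E v => IsPair E (v p) (v a) (v b) :=
  ex <| ex <| (all <| (mem _ _).iff <| (eq none _).or (eq none (some none))).and <|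
    (all <| (mem none (some (some none))).iff (eq none _)).and <|
    all <| (mem none (some none)).iff ((eq none _).or (eq none _))

end Definable

/-! ### The hereditarily finite sets below a bound -/

/-- Ackermann membership on the natural numbers up to `N`. -/
def ackMem (N : ℕ) (a b : Fin (N + 1)) : Prop := (b : ℕ).testBit a

/-- Ackermann codes of the Zermelo numerals. -/
def zermelo : ℕ → ℕ
  | 0 => 0
  | n + 1 => 2 ^ zermelo n

/-- Ackermann codes of Kuratowski pairs. -/
def kuratowski (a b : ℕ) : ℕ := 2 ^ 2 ^ a ||| 2 ^ (2 ^ a ||| 2 ^ b)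

theorem lt_of_testBit {a b : ℕ} (h : b.testBit a) : a < b :=
  a.lt_two_pow_self.trans_le (Nat.ge_two_pow_of_testBit h)

theorem testBit_two_pow_iff {a t : ℕ} : (2 ^ a).testBit t ↔ t = a := by
  rw [Nat.testBit_two_pow, decide_eq_true_eq, eq_comm]

theorem testBit_two_pow_or_iff {a b t : ℕ} : (2 ^ a ||| b).testBit t ↔ t = a ∨ b.testBit t := by
  rw [Nat.testBit_or, Bool.or_eq_true, testBit_two_pow_iff]

theorem left_lt_kuratowski (a b : ℕ) : a < kuratowski a b :=
  (lt_of_testBit (testBit_two_pow_iff.2 rfl)).trans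
    (lt_of_testBit (testBit_two_pow_or_iff.2 (Or.inl rfl)))

theorem right_lt_kuratowski (a b : ℕ) : b < kuratowski a b :=
  (lt_of_testBit (testBit_two_pow_or_iff.2 (Or.inr (testBit_two_pow_iff.2 rfl)))).trans
    (lt_of_testBit (testBit_two_pow_or_iff.2 (Or.inr (testBit_two_pow_iff.2 rfl))))

theorem exists_testBit_iff_mem (A : Finset ℕ) : ∃ c : ℕ, ∀ t, c.testBit t ↔ t ∈ A := by
  induction A using Finset.induction_on with
  | empty => exact ⟨0, by simp⟩
  | insert a A _ ih =>
    obtain ⟨c, hc⟩ := ih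
    exact ⟨2 ^ a ||| c, fun t => by
      rw [testBit_two_pow_or_iff, hc, Finset.mem_insert]⟩

section Ackermann

variable {N : ℕ}

theorem isZero_of_val_eq {x : Fin (N + 1)} (h : (x : ℕ) = 0) : IsZero (ackMem N) x := by
  intro t
  simp [ackMem, h]

theorem isSucc_of_val_eq {a b : Fin (N + 1)} (h : (b : ℕ) = 2 ^ (a : ℕ)) :
    IsSucc (ackMem N) a b := by
  intro t
  rw [ackMem, h, testBit_two_pow_iff, Fin.ext_iff]

theorem isPair_of_val_eq {p a b : Fin (N + 1)} (h : (p : ℕ) = kuratowski a b) :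
    IsPair (ackMem N) p a b := by
  have hp (t : ℕ) : (p : ℕ).testBit t ↔ t = 2 ^ (a : ℕ) ∨ t = 2 ^ (a : ℕ) ||| 2 ^ (b : ℕ) := by
    rw [h, kuratowski, testBit_two_pow_or_iff, testBit_two_pow_iff]
  refine ⟨⟨2 ^ (a : ℕ), (lt_of_testBit ((hp _).2 (Or.inl rfl))).trans p.2⟩,
    ⟨2 ^ (a : ℕ) ||| 2 ^ (b : ℕ), (lt_of_testBit ((hp _).2 (Or.inr rfl))).trans p.2⟩,
    fun t => ?_, fun t => ?_, fun t => ?_⟩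
  · rw [ackMem, hp, Fin.ext_iff, Fin.ext_iff]
  · rw [ackMem, testBit_two_pow_iff, Fin.ext_iff]
  · rw [ackMem, testBit_two_pow_or_iff, testBit_two_pow_iff, Fin.ext_iff, Fin.ext_iff]

theorem isNumeral_of_val_eq {n : ℕ} {x : Fin (N + 1)} (h : (x : ℕ) = zermelo n) :
    IsNumeral (ackMem N) n x := by
  induction n generalizing x with
  | zero => exact isZero_of_val_eq h
  | succ n ih =>
    exact ⟨⟨zermelo n, (Nat.lt_two_pow_self.trans_eq h.symm).trans x.2⟩, isSucc_of_val_eq h, ih rfl⟩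

end Ackermann

/-! ### Representing primitive recursive functions -/

/-- `f` is represented by a definable relation which is correct on numerals in every structure, and
holds of the values of `f` in all sufficiently large finite sets of Ackermann codes. -/
def Representable {n : ℕ} (f : List.Vector ℕ n → ℕ) : Prop :=
  ∃ R : ∀ M : Type, (M → M → Prop) → (Fin n → M) → M → Prop,
    (Definable fun M E (v : Option (Fin n) → M) => R M E (fun i => v (some i)) (v none)) ∧
    (∀ (M : Type) (E : M → M → Prop) (v : List.Vector ℕ n) (x : Fin n → M) (y : M),
      (∀ i, IsNumeral E (v.get i) (x i)) → R M E x y → IsNumeral E (f v) y) ∧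
    ∀ v : List.Vector ℕ n, ∃ N₀, ∀ N ≥ N₀, ∀ (x : Fin n → Fin (N + 1)) (y : Fin (N + 1)),
      (∀ i, (x i : ℕ) = zermelo (v.get i)) → (y : ℕ) = zermelo (f v) → R _ (ackMem N) x y

theorem Definable.apply {n : ℕ} {α : Type}
    {R : ∀ M : Type, (M → M → Prop) → (Fin n → M) → M → Prop}
    (h : Definable fun M E (v : Option (Fin n) → M) => R M E (fun i => v (some i)) (v none))
    (g : Fin n → α) (b : α) : Definable fun M E v => R M E (fun i => v (g i)) (v b) :=
  h.comap fun o : Option (Fin n) => o.elim b g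

theorem representable_zero : @Representable 0 fun _ => 0 :=
  ⟨fun _ E _ y => IsZero E y, .isZero none, fun _ _ _ _ _ _ h => h,
    fun _ => ⟨0, fun _ _ _ _ _ hy => isZero_of_val_eq hy⟩⟩

theorem representable_succ : @Representable 1 fun v => v.head.succ :=
  ⟨fun _ E x y => IsSucc E (x 0) y, .isSucc (some 0) none,
    fun _ _ v x _ hx h => ⟨x 0, h, by simpa using hx 0⟩,
    fun v => ⟨0, fun _ _ x y hx hy => isSucc_of_val_eq (by
      rw [hy, hx 0, List.Vector.get_zero, zermelo])⟩⟩

theorem representable_get {n : ℕ} (i : Fin n) : Representable fun v => v.get i :=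
  ⟨fun _ _ x y => y = x i, .eq none (some i), fun _ _ _ _ _ hx h => h ▸ hx i,
    fun _ => ⟨0, fun _ _ _ _ hx hy => Fin.ext (hy.trans (hx i).symm)⟩⟩

theorem Representable.comp {m n : ℕ} {f : List.Vector ℕ n → ℕ} {g : Fin n → List.Vector ℕ m → ℕ}
    (hf : Representable f) (hg : ∀ i, Representable (g i)) :
    Representable fun a => f (List.Vector.ofFn fun i => g i a) := by
  obtain ⟨F, hF, hF_sound, hF_complete⟩ := hf
  choose G hG hG_sound hG_complete using hg
  refine ⟨fun M E x y => ∃ w : Fin n → M, (∀ i, G i M E x (w i)) ∧ F M E w y, ?_, ?_, ?_⟩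
  · exact .exists_tuple <| (Definable.forall_finite fun i => (hG i).apply _ _).and (hF.apply _ _)
  · rintro M E v x y hx ⟨w, hw, hy⟩
    exact hF_sound M E _ w y (fun i => by simpa using hG_sound i M E v x _ hx (hw i)) hy
  · intro v
    obtain ⟨N₁, hN₁⟩ := hF_complete (List.Vector.ofFn fun i => g i v)
    choose N₂ hN₂ using fun i => hG_complete i v
    refine ⟨N₁ + ∑ i, (N₂ i + zermelo (g i v)), fun N hN x y hx hy => ?_⟩
    have hle (i : Fin n) : N₂ i + zermelo (g i v) ≤ N :=
      (Finset.single_le_sum (f := fun i => N₂ i + zermelo (g i v)) (fun _ _ => Nat.zero_le _)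
        (Finset.mem_univ i)).trans (by omega)
    exact ⟨fun i => ⟨zermelo (g i v), by have := hle i; omega⟩,
      fun i => hN₂ i N (by have := hle i; omega) _ _ hx rfl,
      hN₁ N (by omega) _ _ (fun i => by simp) hy⟩

theorem Definable.apply_cons_cons {n : ℕ} {α : Type}
    {R : ∀ M : Type, (M → M → Prop) → (Fin (n + 2) → M) → M → Prop}
    (h : Definable fun M E (v : Option (Fin (n + 2)) → M) => R M E (fun i => v (some i)) (v none))
    (a a' : α) (g : Fin n → α) (b : α) :
    Definable fun M E v => R M E (Fin.cons (v a) (Fin.cons (v a') fun i => v (g i))) (v b) := by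
  convert h.apply (Fin.cons a (Fin.cons a' g)) b with M E v
  rename_i i
  refine Fin.cases rfl (fun i => ?_) i
  exact Fin.cases rfl (fun i => rfl) i

theorem Representable.prec {n : ℕ} {f : List.Vector ℕ n → ℕ} {g : List.Vector ℕ (n + 2) → ℕ}
    (hf : Representable f) (hg : Representable g) :
    Representable fun v : List.Vector ℕ (n + 1) =>
      v.head.rec (f v.tail) fun y IH => g (y ::ᵥ IH ::ᵥ v.tail) := by
  obtain ⟨F, hF, hF_sound, hF_complete⟩ := hf
  obtain ⟨G, hG, hG_sound, hG_complete⟩ := hg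
  refine ⟨fun M E x y => ∃ s p, E p s ∧ IsPair E p (x 0) y ∧ ∀ q, E q s → ∃ k z, IsPair E q k z ∧
    ((IsZero E k ∧ F M E (fun i => x i.succ) z) ∨ ∃ q' k' z', E q' s ∧ IsPair E q' k' z' ∧
      IsSucc E k' k ∧ G M E (Fin.cons k' (Fin.cons z' fun i => x i.succ)) z), ?_, ?_, ?_⟩
  · exact .ex <| .ex <| (Definable.mem _ (some none)).and <| (Definable.isPair _ _ _).and <|
      .all <| (Definable.mem _ (some (some none))).imp <| .ex <| .ex <|
      (Definable.isPair _ (some none) _).and <|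
      ((Definable.isZero (some none)).and (hF.apply _ none)).or <|
      .ex <| .ex <| .ex <| (Definable.mem _ _).and <|
      (Definable.isPair (some (some none)) (some none) none).and <|
      (Definable.isSucc (some none) _).and <| hG.apply_cons_cons _ _ _ _
  · rintro M E v x y hx ⟨s, p, hps, hp, hs⟩
    have hx_tail (i : Fin n) : IsNumeral E (v.tail.get i) (x i.succ) := by
      simpa using hx i.succ
    have hx_head : IsNumeral E v.head (x 0) := by simpa using hx 0
    beta_reduce
    generalize x 0 = k at hp hx_head
    generalize v.head = m at hx_head ⊢
    induction m generalizing p k y with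
    | zero =>
      obtain ⟨k', z', hp', ⟨-, h⟩ | ⟨_, k'', _, _, _, hk, _⟩⟩ := hs p hps
      · exact hF_sound M E v.tail _ _ hx_tail ((hp.injective hp').2 ▸ h)
      · exact absurd ((hp.injective hp').1 ▸ hx_head) hk.not_isZero
    | succ m ih =>
      obtain ⟨k', z', hp', ⟨h, -⟩ | ⟨q, k'', z'', hqs, hq, hk, hz⟩⟩ := hs p hps
      · exact absurd (hx_head.eq_zero ((hp.injective hp').1 ▸ h)) m.succ_ne_zero
      · obtain ⟨rfl, rfl⟩ := hp.injective hp'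
        have hk' := hx_head.pred hk
        refine hG_sound M E (_ ::ᵥ _ ::ᵥ v.tail) _ _ (fun i => ?_) hz
        refine Fin.cases hk' (fun i => ?_) i
        exact Fin.cases (ih _ _ hqs _ hq hk') hx_tail i
  · intro v
    let r : ℕ → ℕ := fun m => m.rec (f v.tail) fun y IH => g (y ::ᵥ IH ::ᵥ v.tail)
    obtain ⟨N₁, hN₁⟩ := hF_complete v.tail
    choose N₂ hN₂ using fun i => hG_complete (i ::ᵥ r i ::ᵥ v.tail)
    obtain ⟨c, hc⟩ := exists_testBit_iff_mem
      ((Finset.range (v.head + 1)).image fun i => kuratowski (zermelo i) (zermelo (r i)))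
    simp only [Finset.mem_image, Finset.mem_range, Nat.lt_succ_iff] at hc
    refine ⟨c + N₁ + ∑ i ∈ Finset.range v.head, N₂ i, fun N hN x y hx hy => ?_⟩
    have hx_tail (i : Fin n) : (x i.succ : ℕ) = zermelo (v.tail.get i) := by
      simpa using hx i.succ
    have hx_head : (x 0 : ℕ) = zermelo v.head := by simpa using hx 0
    have hpair (i : ℕ) (hi : i ≤ v.head) : kuratowski (zermelo i) (zermelo (r i)) < c :=
      lt_of_testBit ((hc _).2 ⟨i, hi, rfl⟩)
    let num (i : ℕ) (hi : i ≤ v.head) : Fin (N + 1) :=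
      ⟨zermelo i, by have := left_lt_kuratowski (zermelo i) (zermelo (r i)); grind⟩
    let val (i : ℕ) (hi : i ≤ v.head) : Fin (N + 1) :=
      ⟨zermelo (r i), by have := right_lt_kuratowski (zermelo i) (zermelo (r i)); grind⟩
    let pr (i : ℕ) (hi : i ≤ v.head) : Fin (N + 1) :=
      ⟨kuratowski (zermelo i) (zermelo (r i)), by grind⟩
    refine ⟨⟨c, by omega⟩, pr v.head le_rfl, (hc _).2 ⟨_, le_rfl, rfl⟩,
      isPair_of_val_eq (by rw [hx_head, hy]), fun q hq => ?_⟩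
    obtain ⟨i, hi, hqi⟩ := (hc _).1 hq
    refine ⟨num i hi, val i hi, isPair_of_val_eq hqi.symm, ?_⟩
    cases i with
    | zero => exact Or.inl ⟨isZero_of_val_eq rfl, hN₁ N (by omega) _ _ hx_tail rfl⟩
    | succ i =>
      have hi' : i ≤ v.head := by omega
      refine Or.inr ⟨pr i hi', num i hi', val i hi', (hc _).2 ⟨i, hi', rfl⟩,
        isPair_of_val_eq rfl, isSucc_of_val_eq rfl, hN₂ i N ?_ _ _ (fun j => ?_) rfl⟩
      · have := Finset.single_le_sum (f := N₂) (fun _ _ => Nat.zero_le _)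
          (Finset.mem_range.2 (Nat.lt_of_succ_le hi))
        omega
      · refine Fin.cases rfl (fun j => ?_) j
        exact Fin.cases rfl hx_tail j

theorem representable_of_primrec {n : ℕ} {f : List.Vector ℕ n → ℕ} (h : Nat.Primrec' f) :
    Representable f := by
  induction h with
  | zero => exact representable_zero
  | succ => exact representable_succ
  | get i => exact representable_get i
  | comp _ _ _ hf hg => exact hf.comp hg
  | prec _ _ hf hg => exact hf.prec hg

/-! ### The sentences -/

/-- A search property: some set contains zero and is closed under successors as long as the
relation `F` assigns to `x` and the current numeral a nonzero value. -/
def Search (F : ∀ M : Type, (M → M → Prop) → (Fin 2 → M) → M → Prop) (M : Type)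
    (E : M → M → Prop) (x : M) : Prop :=
  ∃ s, (∃ o, E o s ∧ IsZero E o) ∧
    ∀ k, E k s → ∃ y, F M E ![x, k] y ∧ (IsZero E y ∨ ∃ k', E k' s ∧ IsSucc E k k')

/-- For each primitive recursive `f`, some formula has a finite model at the numeral `n` if and
only if `f n` has a zero. -/
theorem exists_formula_of_primrec {f : ℕ → ℕ → ℕ} (hf : Primrec₂ f) :
    ∃ ψ : binLang.Formula (Fin 1), ∀ n : ℕ,
      (∃ (M : Type) (S : binLang.Structure M), Nonempty M ∧ Finite M ∧
        ∃ x : M, IsNumeral (memRel S) n x ∧ ψ.Realize ![x]) ↔ ∃ k, f n k = 0 := by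
  obtain ⟨F, hF, hF_sound, hF_complete⟩ := representable_of_primrec (Nat.Primrec'.prim_iff₂.2 hf)
  have hdef : Definable fun M E (v : Fin 1 → M) => Search F M E (v 0) := by
    refine .ex <| (Definable.ex <| (Definable.mem _ (some none)).and (.isZero none)).and <|
      .all <| (Definable.mem _ (some none)).imp <| .ex <| Definable.and ?_ <|
      (Definable.isZero none).or <| .ex <| (Definable.mem _ (some (some (some none)))).and <|
      .isSucc (some (some none)) none
    have htuple (M : Type) (v : Option (Option (Option (Fin 1))) → M) :
        (fun i => v (![some (some (some 0)), some none] i)) =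
          ![v (some (some (some 0))), v (some none)] := by
      funext i
      fin_cases i <;> rfl
    simpa only [htuple] using hF.apply ![some (some (some (0 : Fin 1))), some none] none
  obtain ⟨ψ, hψ⟩ := hdef
  refine ⟨ψ, fun n => ?_⟩
  simp only [hψ, Matrix.cons_val_zero]
  constructor
  · rintro ⟨M, S, -, hM, x, hx, s, ⟨o, hos, ho⟩, hs⟩
    by_contra! hne
    have hnum (k : ℕ) : ∃ y, memRel S y s ∧ IsNumeral (memRel S) k y := by
      induction k with
      | zero => exact ⟨o, hos, ho⟩
      | succ k ih =>
        obtain ⟨y, hys, hy⟩ := ih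
        obtain ⟨z, hz, hz' | ⟨y', hy's, hy'⟩⟩ := hs y hys
        · have := hF_sound M _ (n ::ᵥ k ::ᵥ .nil) _ _
            (Fin.cases hx (Fin.cases hy finZeroElim)) hz
          exact absurd (this.eq_zero hz') (hne k)
        · exact ⟨y', hy's, y, hy', hy⟩
    choose y _ hy using hnum
    exact not_injective_infinite_finite y fun i j hij => (hy i).unique (hij ▸ hy j)
  · rintro ⟨m, hm⟩
    choose N₁ hN₁ using fun k => hF_complete (n ::ᵥ k ::ᵥ .nil)
    obtain ⟨c, hc⟩ := exists_testBit_iff_mem ((Finset.range (m + 1)).image zermelo)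
    simp only [Finset.mem_image, Finset.mem_range, Nat.lt_succ_iff] at hc
    let N := c + zermelo n + ∑ k ∈ Finset.range (m + 1), (N₁ k + zermelo (f n k))
    have hN (k : ℕ) (hk : k ≤ m) : N₁ k + zermelo (f n k) ≤ N :=
      (Finset.single_le_sum (f := fun k => N₁ k + zermelo (f n k)) (fun _ _ => Nat.zero_le _)
        (Finset.mem_range.2 (Nat.lt_succ_of_le hk))).trans (Nat.le_add_left _ _)
    have hnum (k : ℕ) (hk : k ≤ m) : zermelo k < N + 1 := by
      have := lt_of_testBit ((hc _).2 ⟨k, hk, rfl⟩)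
      omega
    refine ⟨Fin (N + 1), structureOf (ackMem N), inferInstance, inferInstance,
      ⟨zermelo n, by omega⟩, ?_⟩
    rw [memRel_structureOf]
    refine ⟨isNumeral_of_val_eq rfl, ⟨c, by omega⟩,
      ⟨⟨zermelo 0, hnum 0 m.zero_le⟩, (hc _).2 ⟨0, m.zero_le, rfl⟩, isZero_of_val_eq rfl⟩,
      fun k hk => ?_⟩
    obtain ⟨j, hj, hkj⟩ := (hc _).1 hk
    have := hN j hj
    refine ⟨⟨zermelo (f n j), by omega⟩, hN₁ j N (by omega) _ _
      (Fin.cases rfl (Fin.cases hkj.symm finZeroElim)) rfl, ?_⟩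
    by_cases hj0 : f n j = 0
    · exact Or.inl (isZero_of_val_eq (by simp [hj0, zermelo]))
    · have hj' : j + 1 ≤ m := by
        rcases hj.lt_or_eq with h | rfl
        exacts [h, absurd hm hj0]
      exact Or.inr ⟨⟨zermelo (j + 1), hnum _ hj'⟩, (hc _).2 ⟨j + 1, hj', rfl⟩,
        isSucc_of_val_eq (by rw [← hkj]; rfl)⟩

/-- The bounded variable with index `i`. -/
def boundVar {k : ℕ} (i : Fin k) : binLang.Term (Empty ⊕ Fin k) := Term.var (Sum.inr i)

/-- The atomic formula stating that one bounded variable is an element of another. -/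
def memAtom {k : ℕ} (i j : Fin k) : binLang.BoundedFormula Empty k :=
  .rel memSymb ![boundVar i, boundVar j]

/-- The formula stating that the last of `k + 1` bounded variables is the numeral `n`. -/
def numeralFormula : (n k : ℕ) → binLang.BoundedFormula Empty (k + 1)
  | 0, k => .all (.imp (memAtom (Fin.last (k + 1)) (Fin.last k).castSucc) .falsum)
  | n + 1, k => .imp (.all (.imp
      (.all (.imp (memAtom (Fin.last (k + 2)) (Fin.last k).castSucc.castSucc)
        (.equal (boundVar (Fin.last (k + 2))) (boundVar (Fin.last (k + 1)).castSucc))))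
      (.imp (memAtom (Fin.last (k + 1)) (Fin.last k).castSucc)
        (.imp (numeralFormula n (k + 1)) .falsum)))) .falsum

theorem realize_memAtom {M : Type} [S : binLang.Structure M] {k : ℕ} {i j : Fin k}
    {v : Empty → M} {xs : Fin k → M} : (memAtom i j).Realize v xs ↔ memRel S (xs i) (xs j) :=
  BoundedFormula.realize_rel₂

theorem realize_numeralFormula {M : Type} [S : binLang.Structure M] {n k : ℕ} {v : Empty → M}
    {xs : Fin (k + 1) → M} :
    (numeralFormula n k).Realize v xs ↔ IsNumeral (memRel S) n (xs (Fin.last k)) := by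
  induction n generalizing k with
  | zero =>
    simp [numeralFormula, BoundedFormula.Realize, realize_memAtom, IsNumeral, IsZero]
  | succ n ih =>
    simp only [numeralFormula, BoundedFormula.Realize, realize_memAtom, ih, IsNumeral, IsSucc,
      boundVar, Term.realize_var, Sum.elim_inr, Fin.snoc_last, Fin.snoc_castSucc]
    constructor
    · intro h
      by_contra! h'
      exact h fun y h₁ h₂ h₃ => h' y (fun t => ⟨h₁ t, fun e => e ▸ h₂⟩) h₃
    · rintro ⟨y, hy, hn⟩ h
      exact h y (fun t => (hy t).1) ((hy y).2 rfl) hn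

/-- The sentence stating that `ψ` holds of the numeral `n`. -/
def holdsAt (ψ : binLang.BoundedFormula Empty 1) (n : ℕ) : binLang.Sentence :=
  .imp (.all (.imp ψ (.imp (numeralFormula n 0) .falsum))) .falsum

theorem realize_holdsAt {M : Type} [S : binLang.Structure M] {ψ : binLang.Formula (Fin 1)}
    {n : ℕ} : Sentence.Realize M (holdsAt (BoundedFormula.relabel Sum.inr ψ) n) ↔
      ∃ x : M, IsNumeral (memRel S) n x ∧ ψ.Realize ![x] := by
  have hsnoc (x : M) : Fin.snoc default x = ![x] := by
    funext i
    fin_cases i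
    rfl
  simp only [holdsAt, Sentence.Realize, Formula.Realize, BoundedFormula.Realize, hsnoc,
    realize_numeralFormula]
  simp only [Formula.realize_relabel_sumInr, Formula.Realize, imp_false, not_forall, not_not]
  exact exists_congr fun x => exists_prop.trans and_comm

/-! ### Computability of the sentences -/

/-- The symbols in the list encoding of formulas. -/
abbrev Symb : Type := (Σ k, binLang.Term (Empty ⊕ Fin k)) ⊕ ((Σ m, binLang.Relations m) ⊕ ℕ)

/-- The codes of the symbols of a formula. -/
def symbolCodes {k : ℕ} (φ : binLang.BoundedFormula Empty k) : List ℕ :=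
  φ.listEncode.map (Encodable.encode : Symb → ℕ)

theorem encode_sentence (φ : binLang.Sentence) :
    Encodable.encode φ = Encodable.encode (symbolCodes φ) := by
  change Encodable.encode (φ.listEncode : List Symb) = _
  unfold symbolCodes
  induction φ.listEncode with
  | nil => rfl
  | cons a l ih => simp only [List.map_cons, Encodable.encode_list_cons, ih]; rfl

/-- The code of the `i`-th among `k` bounded variables. -/
def varCode (k i : ℕ) : ℕ := 2 * Nat.pair k (Nat.pair (2 * (2 * i + 1)) 0 + 1)

/-- The code of a structural symbol. -/
def natCode (n : ℕ) : ℕ := 2 * (2 * n + 1) + 1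

/-- The codes of the atomic formula `memAtom i j` in `k` bounded variables. -/
def memCodes (k i j : ℕ) : List ℕ :=
  [Encodable.encode (Sum.inr (Sum.inl ⟨2, memSymb⟩) : Symb), natCode k, varCode k i, varCode k j]

section Codes

variable {k : ℕ}

theorem symbolCodes_falsum :
    symbolCodes (.falsum : binLang.BoundedFormula Empty k) = [natCode (k + 2)] := rfl

theorem symbolCodes_equal (i j : Fin k) :
    symbolCodes (.equal (boundVar i) (boundVar j)) = [varCode k i, varCode k j] := rfl

theorem symbolCodes_memAtom (i j : Fin k) : symbolCodes (memAtom i j) = memCodes k i j := rfl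

theorem symbolCodes_imp (φ ψ : binLang.BoundedFormula Empty k) :
    symbolCodes (φ.imp ψ) = natCode 0 :: (symbolCodes φ ++ symbolCodes ψ) := by
  simp only [symbolCodes, BoundedFormula.listEncode, List.cons_append, List.map_cons,
    List.map_append]
  rfl

theorem symbolCodes_all (φ : binLang.BoundedFormula Empty (k + 1)) :
    symbolCodes φ.all = natCode 1 :: symbolCodes φ := rfl

end Codes

/-- The codes of `numeralFormula 0 k`. -/
def zeroCodes (k : ℕ) : List ℕ :=
  natCode 1 :: natCode 0 :: (memCodes (k + 2) (k + 1) k ++ [natCode (k + 4)])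

/-- The codes in `numeralFormula (n + 1) k` before those of `numeralFormula n (k + 1)`. -/
def succOpening (k : ℕ) : List ℕ :=
  natCode 0 :: natCode 1 :: natCode 0 :: natCode 1 :: natCode 0 ::
    (memCodes (k + 3) (k + 2) k ++ varCode (k + 3) (k + 2) :: varCode (k + 3) (k + 1) ::
      natCode 0 :: (memCodes (k + 2) (k + 1) k ++ [natCode 0]))

/-- The codes in `numeralFormula (n + 1) k` after those of `numeralFormula n (k + 1)`. -/
def succClosing (k : ℕ) : List ℕ := [natCode (k + 4), natCode (k + 3)]

/-- The codes of `numeralFormula i (m - i)`. -/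
def numeralCodes (m i : ℕ) : List ℕ :=
  i.rec (zeroCodes m) fun i IH => succOpening (m - (i + 1)) ++ (IH ++ succClosing (m - (i + 1)))

theorem symbolCodes_numeralFormula (n k : ℕ) :
    symbolCodes (numeralFormula n k) = numeralCodes (k + n) n := by
  induction n generalizing k with
  | zero => rfl
  | succ n ih =>
    have hk : k + (n + 1) - (n + 1) = k := by omega
    have hn : k + (n + 1) = k + 1 + n := by omega
    have hrec : numeralCodes (k + (n + 1)) (n + 1) =
        succOpening k ++ (numeralCodes (k + 1 + n) n ++ succClosing k) := by
      rw [← hn]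
      exact congrArg (fun j => succOpening j ++ (numeralCodes (k + (n + 1)) n ++ succClosing j)) hk
    rw [hrec, ← ih]
    simp only [numeralFormula, symbolCodes_imp, symbolCodes_all, symbolCodes_memAtom,
      symbolCodes_equal, symbolCodes_falsum, succOpening, succClosing]
    simp

theorem primrec_natCode : Primrec natCode :=
  Primrec.nat_double_succ.comp Primrec.nat_double_succ

theorem primrec_varCode : Primrec₂ varCode :=
  Primrec.nat_double.comp₂ <| Primrec₂.natPair.comp₂ Primrec₂.left <| Primrec.succ.comp₂ <|
    Primrec₂.natPair.comp₂ (Primrec.nat_double.comp₂ (Primrec.nat_double_succ.comp₂ Primrec₂.right))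
      (Primrec₂.const 0)

section Primrec

variable {f g h : ℕ → ℕ} {l l' : ℕ → List ℕ}

theorem primrec_cons (hf : Primrec f) (hl : Primrec l) : Primrec fun k => f k :: l k :=
  Primrec.list_cons.comp hf hl

theorem primrec_append (hl : Primrec l) (hl' : Primrec l') : Primrec fun k => l k ++ l' k :=
  Primrec.list_append.comp hl hl'

theorem primrec_memCodes (hf : Primrec f) (hg : Primrec g) (hh : Primrec h) :
    Primrec fun k => memCodes (f k) (g k) (h k) :=
  primrec_cons (.const _) <| primrec_cons (primrec_natCode.comp hf) <|
    primrec_cons (primrec_varCode.comp hf hg) <| primrec_cons (primrec_varCode.comp hf hh) <|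
    .const _

theorem primrec_add_const (c : ℕ) : Primrec fun k : ℕ => k + c :=
  Primrec.nat_add.comp .id (.const c)

theorem primrec_zeroCodes : Primrec zeroCodes :=
  primrec_cons (.const _) <| primrec_cons (.const _) <| primrec_append
    (primrec_memCodes (primrec_add_const 2) (primrec_add_const 1) .id) <|
    primrec_cons (primrec_natCode.comp (primrec_add_const 4)) (.const _)

theorem primrec_succOpening : Primrec succOpening :=
  primrec_cons (.const _) <| primrec_cons (.const _) <| primrec_cons (.const _) <|
    primrec_cons (.const _) <| primrec_cons (.const _) <| primrec_append
    (primrec_memCodes (primrec_add_const 3) (primrec_add_const 2) .id) <|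
    primrec_cons (primrec_varCode.comp (primrec_add_const 3) (primrec_add_const 2)) <|
    primrec_cons (primrec_varCode.comp (primrec_add_const 3) (primrec_add_const 1)) <|
    primrec_cons (.const _) <| primrec_append
    (primrec_memCodes (primrec_add_const 2) (primrec_add_const 1) .id) (.const _)

theorem primrec_succClosing : Primrec succClosing :=
  primrec_cons (primrec_natCode.comp (primrec_add_const 4)) <|
    primrec_cons (primrec_natCode.comp (primrec_add_const 3)) (.const _)

end Primrec

theorem primrec_numeralCodes : Primrec₂ numeralCodes := by
  have hlevel : Primrec₂ fun (m : ℕ) (p : ℕ × List ℕ) => m - (p.1 + 1) :=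
    Primrec.nat_sub.comp₂ Primrec₂.left
      (Primrec.succ.comp₂ (Primrec.fst.comp₂ Primrec₂.right))
  exact Primrec.nat_rec primrec_zeroCodes <| Primrec.list_append.comp₂
    (primrec_succOpening.comp₂ hlevel) <| Primrec.list_append.comp₂
    (Primrec.snd.comp₂ Primrec₂.right) (primrec_succClosing.comp₂ hlevel)

theorem primrec_encode_holdsAt (ψ : binLang.BoundedFormula Empty 1) :
    Primrec fun n => Encodable.encode (holdsAt ψ n) := by
  have hcodes (n : ℕ) : symbolCodes (holdsAt ψ n) =
      ([natCode 0, natCode 1, natCode 0] ++ symbolCodes ψ ++ [natCode 0]) ++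
        (numeralCodes n n ++ [natCode 3, natCode 2]) := by
    rw [holdsAt, symbolCodes_imp, symbolCodes_all, symbolCodes_imp, symbolCodes_imp,
      symbolCodes_numeralFormula, symbolCodes_falsum, symbolCodes_falsum]
    simp
  simp only [encode_sentence, hcodes]
  exact Primrec.encode.comp <| primrec_append (.const _) <|
    primrec_append (primrec_numeralCodes.comp .id .id) (.const _)

end BinaryTrakhtenbrot

open BinaryTrakhtenbrot

/-- Undecidability of finite satisfiability for a single binary relation: no algorithm
decides, given a sentence whose only non-logical symbol is one binary predicate letter,
whether it has a finite model (a model with nonempty finite domain). -/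
theorem binary_relation_finite_satisfiability_undecidable :
    ¬ ∃ f : ℕ → Bool, Computable f ∧
      ∀ φ : binLang.Sentence, (f (Encodable.encode φ) = true ↔ FinSatSentence φ) := by
  rintro ⟨d, hd, hdec⟩
  let f (n k : ℕ) : ℕ :=
    bif (Nat.Partrec.Code.evaln k (Denumerable.ofNat _ n) 0).isSome then 0 else 1
  have hf : Primrec₂ f :=
    Primrec.cond (Primrec.option_isSome.comp <| Nat.Partrec.Code.primrec_evaln.comp <|
      (Primrec.snd.pair ((Primrec.ofNat _).comp .fst)).pair (.const 0)) (.const 0) (.const 1)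
  obtain ⟨ψ, hψ⟩ := exists_formula_of_primrec hf
  refine ComputablePred.halting_problem 0 <| ComputablePred.computable_iff.2
    ⟨fun c => d (Encodable.encode
        (holdsAt (BoundedFormula.relabel Sum.inr ψ) (Encodable.encode c))),
      hd.comp <| (primrec_encode_holdsAt _).to_comp.comp Computable.encode, ?_⟩
  funext c
  rw [hdec]
  simp only [FinSatSentence, realize_holdsAt, hψ, f, Denumerable.ofNat_encode, Part.dom_iff_mem,
    Nat.Partrec.Code.evaln_complete]
  rw [exists_comm]
  refine propext (exists_congr fun k => ?_)
  cases Nat.Partrec.Code.evaln k c 0 <;> simp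
end
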